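/- Let E : (0,∞) × [0,∞) → (0,∞) be a C¹ function of (Δ, t) satisfying the PDE α ∂/∂t (E/(1+E/Δ)) = ∂E/∂Δ⁻¹ (equivalently α (∂E/∂t) / (Δ+E)² · Δ² = -Δ² ∂E/∂Δ, i.e. α (∂E/∂t)/(Δ+E)² = -∂E/∂Δ), with ∂E/∂t ≠ 0 everywhere. Fix Δ(0) > 0 and define Δ(t) = α / (α/(Δ(0)+E(Δ(0),0)) − t) − E(Δ(0),0) for t in an interval where this is positive. Then E(Δ(t), t) = E(Δ(0), 0) for all such t; i.e., E is constant along the characteristic curve t ↦ Δ(t). -/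

import Mathlib

open MeasureTheory Set Filter Topology

/-- A smooth step function rising from `0` to `1` on `[c₁, c₂]`. -/
theorem exists_smooth_step {c₁ c₂ : ℝ} (h : c₁ < c₂) :
    ∃ Φ φ : ℝ → ℝ, (∀ x, HasDerivAt Φ (φ x) x) ∧ (∀ x, 0 ≤ φ x) ∧ (∀ x, 0 ≤ Φ x) ∧
      (∀ x, Φ x ≤ 1) ∧ (∀ x ≤ c₁, Φ x = 0) ∧ (∀ x ≥ c₂, Φ x = 1) ∧
      ∀ x, φ x ≠ 0 → c₁ ≤ x ∧ x ≤ c₂ := by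
  have hc : 0 < c₂ - c₁ := sub_pos.2 h
  set Φ : ℝ → ℝ := fun x => Real.smoothTransition ((x - c₁) / (c₂ - c₁))
  have hΦ₀ : ∀ x ≤ c₁, Φ x = 0 := fun x hx =>
    Real.smoothTransition.zero_of_nonpos (div_nonpos_of_nonpos_of_nonneg (by linarith) hc.le)
  have hΦ₁ : ∀ x ≥ c₂, Φ x = 1 := fun x hx =>
    Real.smoothTransition.one_of_one_le ((one_le_div hc).2 (by linarith))
  have hdiff : Differentiable ℝ Φ := by
    have h₁ : Differentiable ℝ Real.smoothTransition :=
      (Real.smoothTransition.contDiff (n := 1)).differentiable (by simp)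
    exact h₁.comp (by fun_prop)
  have hmono : Monotone Φ := fun x y hxy =>
    Real.smoothTransition.monotone (by gcongr)
  refine ⟨Φ, deriv Φ, fun x => (hdiff x).hasDerivAt, fun x => hmono.deriv_nonneg,
    fun x => Real.smoothTransition.nonneg _, fun x => Real.smoothTransition.le_one _, hΦ₀, hΦ₁,
    fun x hx => ⟨?_, ?_⟩⟩
  · by_contra! hlt
    refine hx (((hasDerivAt_const x (0 : ℝ)).congr_of_eventuallyEq ?_).deriv)
    filter_upwards [eventually_lt_nhds hlt] with y hy using hΦ₀ y hy.le
  · by_contra! hlt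
    refine hx (((hasDerivAt_const x (1 : ℝ)).congr_of_eventuallyEq ?_).deriv)
    filter_upwards [eventually_gt_nhds hlt] with y hy using hΦ₁ y hy.le

/-- The fundamental theorem of calculus for a nonnegative derivative, as a Lebesgue integral. -/
theorem lintegral_ofReal_deriv_of_nonneg {f f' : ℝ → ℝ} {a b : ℝ} (hab : a ≤ b)
    (hf : ∀ x ∈ Icc a b, HasDerivAt f (f' x) x) (hf' : ∀ x ∈ Icc a b, 0 ≤ f' x) :
    ∫⁻ x in Ioc a b, ENNReal.ofReal (f' x) = ENNReal.ofReal (f b - f a) := by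
  have hcont : ContinuousOn f (Icc a b) := fun x hx => (hf x hx).continuousAt.continuousWithinAt
  have hint : IntervalIntegrable f' volume a b := by
    apply intervalIntegral.intervalIntegrable_deriv_of_nonneg (g := f)
    · rwa [uIcc_of_le hab]
    · intro x hx
      rw [min_eq_left hab, max_eq_right hab] at hx
      exact hf x (Ioo_subset_Icc_self hx)
    · intro x hx
      rw [min_eq_left hab, max_eq_right hab] at hx
      exact hf' x (Ioo_subset_Icc_self hx)
  rw [← intervalIntegral.integral_eq_sub_of_hasDerivAt (by rwa [uIcc_of_le hab]) hint,
    intervalIntegral.integral_of_le hab, ofReal_integral_eq_lintegral_ofReal hint.1]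
  exact (ae_restrict_iff' measurableSet_Ioc).2
    (ae_of_all _ fun x hx => hf' x (Ioc_subset_Icc_self hx))

/-- A partial derivative of a separately differentiable function is jointly measurable on
rectangles. -/
theorem aemeasurable_partial_deriv {F P : ℝ → ℝ → ℝ} {a b s t : ℝ}
    (hx : ∀ x ≥ a, ∀ y ≥ s, HasDerivAt (fun x => F x y) (P x y) x)
    (hy : ∀ x ≥ a, ∀ y ≥ s, ContinuousAt (fun y => F x y) y) :
    AEMeasurable (Function.uncurry P)
      ((volume.restrict (Ioc a b)).prod (volume.restrict (Ioc s t))) := by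
  set G : ℝ → ℝ → ℝ := fun x y => F (max x a) (max y s) with hG
  have hGm : Measurable (Function.uncurry G) := by
    apply measurable_uncurry_of_continuous_of_measurable
    · intro y
      refine continuous_iff_continuousAt.2 fun x => ?_
      exact ContinuousAt.comp (f := fun x => max x a) (g := fun x => F x (max y s))
        (hx _ (le_max_right _ _) _ (le_max_right _ _)).continuousAt (by fun_prop)
    · intro x
      refine (continuous_iff_continuousAt.2 fun y => ?_).measurable
      exact ContinuousAt.comp (f := fun y => max y s) (g := fun y => F (max x a) y)
        (hy _ (le_max_right _ _) _ (le_max_right _ _)) (by fun_prop)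
  have hPm : Measurable fun z : ℝ × ℝ => P (max z.1 a) (max z.2 s) := by
    refine measurable_of_tendsto_metrizable
      (f := fun (n : ℕ) z => ((1 : ℝ) / (n + 1))⁻¹ *
        (Function.uncurry G (max z.1 a + 1 / (n + 1), z.2) - Function.uncurry G z)) ?_ ?_
    · intro n
      have h₁ : Measurable fun z : ℝ × ℝ => (max z.1 a + 1 / ((n : ℝ) + 1), z.2) := by fun_prop
      exact ((hGm.comp h₁).sub hGm).const_mul _
    · rw [tendsto_pi_nhds]
      intro z
      have h₁ := (hx (max z.1 a) (le_max_right _ _) (max z.2 s)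
        (le_max_right _ _)).tendsto_slope_zero
      have h₂ : Tendsto (fun n : ℕ => (1 : ℝ) / (n + 1)) atTop (𝓝[≠] 0) :=
        tendsto_nhdsWithin_iff.2 ⟨tendsto_one_div_add_atTop_nhds_zero_nat,
          Eventually.of_forall fun n => (by positivity : (1 : ℝ) / (n + 1) ≠ 0)⟩
      refine (h₁.comp h₂).congr fun n => ?_
      have h₃ : max (max z.1 a + 1 / ((n : ℝ) + 1)) a = max z.1 a + 1 / ((n : ℝ) + 1) :=
        max_eq_left (by have : (0 : ℝ) < 1 / (n + 1) := by positivity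
                        linarith [le_max_right z.1 a])
      simp only [Function.comp, hG, Function.uncurry, smul_eq_mul, h₃]
  refine ⟨_, hPm, ?_⟩
  rw [Measure.prod_restrict]
  refine (ae_restrict_iff' (measurableSet_Ioc.prod measurableSet_Ioc)).2 (ae_of_all _ ?_)
  rintro ⟨x, y⟩ ⟨h₁, h₂⟩
  simp [Function.uncurry, max_eq_left h₁.1.le, max_eq_left h₂.1.le]

/-- Integrating a partial derivative over a rectangle in either order. -/
theorem lintegral_edge_diff_eq {F P : ℝ → ℝ → ℝ} {a b s t : ℝ} (hab : a ≤ b)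
    (hx : ∀ x ≥ a, ∀ y ≥ s, HasDerivAt (fun x => F x y) (P x y) x)
    (hy : ∀ x ≥ a, ∀ y ≥ s, ContinuousAt (fun y => F x y) y)
    (hP : ∀ x ≥ a, ∀ y ≥ s, 0 ≤ P x y) :
    ∫⁻ y in Ioc s t, ENNReal.ofReal (F b y - F a y) =
      ∫⁻ x in Ioc a b, ∫⁻ y in Ioc s t, ENNReal.ofReal (P x y) := by
  rw [lintegral_lintegral_swap (aemeasurable_partial_deriv hx hy).ennreal_ofReal]
  refine setLIntegral_congr_fun measurableSet_Ioc fun y h₁ => ?_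
  exact (lintegral_ofReal_deriv_of_nonneg (f := fun x => F x y) hab
    (fun x h₂ => hx x h₂.1 y h₁.1.le) fun x h₂ => hP x h₂.1 y h₁.1.le).symm

theorem hasDerivAt_neg_div_add {α d x : ℝ} (h : 0 < x + d) :
    HasDerivAt (fun x => -(α / (x + d))) (α / (x + d) ^ 2) x := by
  have h₁ := ((hasDerivAt_const x α).div ((hasDerivAt_id x).add_const d) h.ne').neg
  exact h₁.congr_deriv (by simp [neg_div])

theorem lintegral_div_add_sq {α d a b : ℝ} (hα : 0 ≤ α) (hab : a ≤ b) (h : 0 < a + d) :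
    ∫⁻ x in Ioc a b, ENNReal.ofReal (α / (x + d) ^ 2) =
      ENNReal.ofReal (α / (a + d) - α / (b + d)) := by
  rw [lintegral_ofReal_deriv_of_nonneg (f := fun x => -(α / (x + d))) hab
    (fun x hx => hasDerivAt_neg_div_add (by linarith [hx.1])) fun x _ => by positivity]
  congr 1
  ring

/-- If `E` crosses `[c₁, c₂]` on every horizontal segment of a rectangle and its level curves
have slope at most `α / (x + d) ^ 2`, the height is bounded by the integral of that slope. -/
theorem height_le_of_crossing {E p q : ℝ → ℝ → ℝ} {a b s t c₁ c₂ α d : ℝ} (hα : 0 ≤ α)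
    (hab : a ≤ b) (hst : s ≤ t) (hc : c₁ < c₂) (hd : 0 < a + d)
    (hx : ∀ x ≥ a, ∀ y ≥ s, HasDerivAt (fun x => E x y) (p x y) x)
    (hy : ∀ x ≥ a, ∀ y ≥ s, HasDerivAt (fun y => E x y) (-q x y) y)
    (hp : ∀ x ≥ a, ∀ y ≥ s, 0 ≤ p x y) (hq : ∀ x ≥ a, ∀ y ≥ s, 0 ≤ q x y)
    (hpq : ∀ x ≥ a, ∀ y ≥ s, c₁ ≤ E x y → E x y ≤ c₂ → p x y ≤ α / (x + d) ^ 2 * q x y)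
    (hleft : ∀ y ∈ Ioc s t, E a y ≤ c₁) (hright : ∀ y ∈ Ioc s t, c₂ ≤ E b y) :
    t - s ≤ α / (a + d) - α / (b + d) := by
  obtain ⟨Φ, φ, hΦ, hφ, hΦn, hΦle, hΦ₀, hΦ₁, hsupp⟩ := exists_smooth_step hc
  have key := lintegral_edge_diff_eq (F := fun x y => Φ (E x y))
    (P := fun x y => φ (E x y) * p x y) (a := a) (b := b) (s := s) (t := t) hab
    (fun x h₁ y h₂ => (hΦ _).comp x (hx x h₁ y h₂))
    (fun x h₁ y h₂ => ((hΦ _).comp y (hy x h₁ y h₂)).continuousAt)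
    (fun x h₁ y h₂ => mul_nonneg (hφ _) (hp x h₁ y h₂))
  have hL : ∫⁻ y in Ioc s t, ENNReal.ofReal (Φ (E b y) - Φ (E a y)) =
      ENNReal.ofReal (t - s) := by
    rw [setLIntegral_congr_fun (g := fun _ => 1) measurableSet_Ioc]
    · simp
    · intro y h₁
      simp [hΦ₀ _ (hleft y h₁), hΦ₁ _ (hright y h₁)]
  have hR : ∫⁻ x in Ioc a b, ∫⁻ y in Ioc s t, ENNReal.ofReal (φ (E x y) * p x y) ≤
      ∫⁻ x in Ioc a b, ENNReal.ofReal (α / (x + d) ^ 2) := by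
    refine setLIntegral_mono' measurableSet_Ioc fun x h₁ => ?_
    calc ∫⁻ y in Ioc s t, ENNReal.ofReal (φ (E x y) * p x y)
        ≤ ∫⁻ y in Ioc s t, ENNReal.ofReal (α / (x + d) ^ 2) *
            ENNReal.ofReal (φ (E x y) * q x y) := by
          refine setLIntegral_mono' measurableSet_Ioc fun y h₂ => ?_
          rw [← ENNReal.ofReal_mul (by positivity)]
          refine ENNReal.ofReal_le_ofReal ?_
          rcases eq_or_ne (φ (E x y)) 0 with h | h
          · simp [h]
          · have h₃ := mul_le_mul_of_nonneg_left
              (hpq x h₁.1.le y h₂.1.le (hsupp _ h).1 (hsupp _ h).2) (hφ (E x y))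
            linarith
      _ = ENNReal.ofReal (α / (x + d) ^ 2) *
            ENNReal.ofReal (-Φ (E x t) - -Φ (E x s)) := by
          rw [lintegral_const_mul' _ _ ENNReal.ofReal_ne_top]
          congr 1
          refine lintegral_ofReal_deriv_of_nonneg (f := fun y => -Φ (E x y)) hst
            (fun y h₂ => ?_) fun y h₂ => mul_nonneg (hφ _) (hq x h₁.1.le y h₂.1)
          exact ((hΦ _).comp y (hy x h₁.1.le y h₂.1)).neg.congr_deriv (by ring)
      _ ≤ ENNReal.ofReal (α / (x + d) ^ 2) * 1 := by
          gcongr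
          rw [ENNReal.ofReal_le_one]
          linarith [hΦn (E x t), hΦle (E x s)]
      _ = _ := mul_one _
  rw [hL] at key
  rw [← key, lintegral_div_add_sq hα hab hd] at hR
  refine (ENNReal.ofReal_le_ofReal_iff ?_).1 hR
  rw [sub_nonneg]
  gcongr

/-- If `E` crosses `[c₁, c₂]` on every vertical segment of a rectangle and its level curves
have slope at least `α / (x + d) ^ 2`, the height is at least the integral of that slope. -/
theorem le_height_of_crossing {E p q : ℝ → ℝ → ℝ} {a b s t c₁ c₂ α d : ℝ} (hα : 0 ≤ α)
    (hab : a ≤ b) (hst : s ≤ t) (hc : c₁ < c₂) (hd : 0 < a + d)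
    (hx : ∀ x ≥ a, ∀ y ≥ s, HasDerivAt (fun x => E x y) (p x y) x)
    (hy : ∀ x ≥ a, ∀ y ≥ s, HasDerivAt (fun y => E x y) (-q x y) y)
    (hp : ∀ x ≥ a, ∀ y ≥ s, 0 ≤ p x y) (hq : ∀ x ≥ a, ∀ y ≥ s, 0 ≤ q x y)
    (hpq : ∀ x ≥ a, ∀ y ≥ s, c₁ ≤ E x y → E x y ≤ c₂ → α / (x + d) ^ 2 * q x y ≤ p x y)
    (htop : ∀ x ∈ Ioc a b, E x t ≤ c₁) (hbot : ∀ x ∈ Ioc a b, c₂ ≤ E x s) :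
    α / (a + d) - α / (b + d) ≤ t - s := by
  obtain ⟨Φ, φ, hΦ, hφ, hΦn, hΦle, hΦ₀, hΦ₁, hsupp⟩ := exists_smooth_step hc
  have key := lintegral_edge_diff_eq (F := fun x y => Φ (E x y))
    (P := fun x y => φ (E x y) * p x y) (a := a) (b := b) (s := s) (t := t) hab
    (fun x h₁ y h₂ => (hΦ _).comp x (hx x h₁ y h₂))
    (fun x h₁ y h₂ => ((hΦ _).comp y (hy x h₁ y h₂)).continuousAt)
    (fun x h₁ y h₂ => mul_nonneg (hφ _) (hp x h₁ y h₂))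
  have hL : ∫⁻ y in Ioc s t, ENNReal.ofReal (Φ (E b y) - Φ (E a y)) ≤
      ENNReal.ofReal (t - s) := by
    calc _ ≤ ∫⁻ y in Ioc s t, 1 := by
          refine setLIntegral_mono' measurableSet_Ioc fun y _ => ?_
          rw [ENNReal.ofReal_le_one]
          linarith [hΦn (E a y), hΦle (E b y)]
      _ = _ := by simp
  have hR : ∫⁻ x in Ioc a b, ENNReal.ofReal (α / (x + d) ^ 2) ≤
      ∫⁻ x in Ioc a b, ∫⁻ y in Ioc s t, ENNReal.ofReal (φ (E x y) * p x y) := by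
    refine setLIntegral_mono' measurableSet_Ioc fun x h₁ => ?_
    calc ENNReal.ofReal (α / (x + d) ^ 2)
        = ENNReal.ofReal (α / (x + d) ^ 2) *
            ENNReal.ofReal (-Φ (E x t) - -Φ (E x s)) := by
          simp [hΦ₀ _ (htop x h₁), hΦ₁ _ (hbot x h₁)]
      _ = ∫⁻ y in Ioc s t, ENNReal.ofReal (α / (x + d) ^ 2) *
            ENNReal.ofReal (φ (E x y) * q x y) := by
          rw [lintegral_const_mul' _ _ ENNReal.ofReal_ne_top]
          congr 1
          refine (lintegral_ofReal_deriv_of_nonneg (f := fun y => -Φ (E x y)) hst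
            (fun y h₂ => ?_) fun y h₂ => mul_nonneg (hφ _) (hq x h₁.1.le y h₂.1)).symm
          exact ((hΦ _).comp y (hy x h₁.1.le y h₂.1)).neg.congr_deriv (by ring)
      _ ≤ ∫⁻ y in Ioc s t, ENNReal.ofReal (φ (E x y) * p x y) := by
          refine setLIntegral_mono' measurableSet_Ioc fun y h₂ => ?_
          rw [← ENNReal.ofReal_mul (by positivity)]
          refine ENNReal.ofReal_le_ofReal ?_
          rcases eq_or_ne (φ (E x y)) 0 with h | h
          · simp [h]
          · have h₃ := mul_le_mul_of_nonneg_left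
              (hpq x h₁.1.le y h₂.1.le (hsupp _ h).1 (hsupp _ h).2) (hφ (E x y))
            linarith
  rw [← key, lintegral_div_add_sq hα hab hd] at hR
  exact (ENNReal.ofReal_le_ofReal_iff (sub_nonneg.2 hst)).1 (hR.trans hL)

/-- A solution of the quasilinear equation `E_x = -α / (x + g E) ^ 2 * E_y` that is increasing in
`x` and decreasing in `y` is constant along the characteristic curve starting at `(a, 0)`. -/
theorem eq_along_characteristic {E p q : ℝ → ℝ → ℝ} {g : ℝ → ℝ} {a b T α : ℝ} (hα : 0 < α)
    (hg : Continuous g) (hgE : ∀ x > 0, ∀ y ≥ 0, 0 < g (E x y))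
    (hx : ∀ x > 0, ∀ y ≥ 0, HasDerivAt (fun x => E x y) (p x y) x)
    (hy : ∀ x > 0, ∀ y ≥ 0, HasDerivAt (fun y => E x y) (-q x y) y)
    (hpq : ∀ x > 0, ∀ y ≥ 0, p x y = α / (x + g (E x y)) ^ 2 * q x y)
    (hq : ∀ x > 0, ∀ y ≥ 0, 0 < q x y) (ha : 0 < a) (hab : a ≤ b) (hT : 0 ≤ T)
    (hchar : α / (a + g (E a 0)) - α / (b + g (E a 0)) = T) :
    E b T = E a 0 := by
  have hp : ∀ x > 0, ∀ y ≥ 0, 0 < p x y := fun x h₁ y h₂ => by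
    have := hgE x h₁ y h₂
    have := hq x h₁ y h₂
    rw [hpq x h₁ y h₂]
    positivity
  have hanti : ∀ x > 0, StrictAntiOn (fun y => E x y) (Ici 0) := fun x h₁ =>
    strictAntiOn_of_deriv_neg (convex_Ici 0)
      (fun y h₂ => (hy x h₁ y h₂).continuousAt.continuousWithinAt) fun y h₂ => by
        rw [interior_Ici] at h₂
        rw [(hy x h₁ y h₂.le).deriv]
        linarith [hq x h₁ y h₂.le]
  have hmono : ∀ y ≥ 0, StrictMonoOn (fun x => E x y) (Ioi 0) := fun y h₂ =>
    strictMonoOn_of_deriv_pos (convex_Ioi 0)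
      (fun x h₁ => (hx x h₁ y h₂).continuousAt.continuousWithinAt) fun x h₁ => by
        rw [interior_Ioi] at h₁
        rw [(hx x h₁ y h₂).deriv]
        exact hp x h₁ y h₂
  have hb : 0 < b := ha.trans_le hab
  have hc : 0 < g (E a 0) := hgE a ha 0 le_rfl
  set c := g (E a 0)
  have hcont : ∀ b' > 0, ContinuousAt (fun d => α / (a + d) - α / (b' + d)) c := fun b' hb' =>
    (continuousAt_const.div (by fun_prop) (by positivity)).sub
      (continuousAt_const.div (by fun_prop) (by positivity))
  rcases lt_trichotomy (E b T) (E a 0) with hlt | heq | hgt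
  · exfalso
    obtain ⟨b', hbb', hlt'⟩ := ((((hx b hb T hT).continuousAt.eventually_lt_const hlt).filter_mono
      nhdsWithin_le_nhds).and (self_mem_nhdsWithin (s := Ioi b))).exists.imp fun _ h => h.symm
    have hb' : 0 < b' := hb.trans hbb'
    have hlim : α / (a + c) - α / (b' + c) ≤ T := by
      refine le_of_tendsto ((hcont b' hb').tendsto.mono_left (nhdsWithin_le_nhds (s := Ioi c))) ?_
      filter_upwards [self_mem_nhdsWithin] with d hd
      rw [mem_Ioi] at hd
      obtain ⟨δ, hδ, hball⟩ := Metric.eventually_nhds_iff.1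
        ((hg.tendsto (E a 0)).eventually_lt_const hd)
      rw [← sub_zero T]
      refine le_height_of_crossing (c₁ := max (E b' T) (E a 0 - δ / 2)) (c₂ := E a 0) hα.le
        (hab.trans hbb'.le) hT (max_lt hlt' (by linarith)) (by linarith)
        (fun x h₁ => hx x (ha.trans_le h₁)) (fun x h₁ => hy x (ha.trans_le h₁))
        (fun x h₁ y h₂ => (hp x (ha.trans_le h₁) y h₂).le)
        (fun x h₁ y h₂ => (hq x (ha.trans_le h₁) y h₂).le) ?_ ?_ ?_
      · intro x h₁ y h₂ h₃ h₄
        have hx0 := ha.trans_le h₁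
        have h₅ : g (E x y) < d := hball (by
          rw [Real.dist_eq, abs_lt]
          constructor <;> linarith [(le_max_right _ _).trans h₃])
        have := hgE x hx0 y h₂
        have := hq x hx0 y h₂
        rw [hpq x hx0 y h₂]
        gcongr
      · intro x h₁
        exact le_max_of_le_left
          ((hmono T hT).monotoneOn (mem_Ioi.2 (ha.trans h₁.1)) (mem_Ioi.2 hb') h₁.2)
      · intro x h₁
        exact ((hmono 0 le_rfl) (mem_Ioi.2 ha) (mem_Ioi.2 (ha.trans h₁.1)) h₁.1).le
    have : α / (b' + c) < α / (b + c) := by gcongr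
    linarith
  · exact heq
  · exfalso
    obtain ⟨T', hTT', hgt'⟩ := ((((hy b hb T hT).continuousAt.eventually_const_lt hgt).filter_mono
      nhdsWithin_le_nhds).and (self_mem_nhdsWithin (s := Ioi T))).exists.imp fun _ h => h.symm
    have hT' : 0 ≤ T' := hT.trans hTT'.le
    have hlim : T' ≤ α / (a + c) - α / (b + c) := by
      refine ge_of_tendsto ((hcont b hb).tendsto.mono_left (nhdsWithin_le_nhds (s := Iio c))) ?_
      filter_upwards [self_mem_nhdsWithin, nhdsWithin_le_nhds (eventually_gt_nhds hc)] with d hd hd0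
      rw [mem_Iio] at hd
      obtain ⟨δ, hδ, hball⟩ := Metric.eventually_nhds_iff.1
        ((hg.tendsto (E a 0)).eventually_const_lt hd)
      rw [← sub_zero T']
      refine height_le_of_crossing (c₁ := E a 0) (c₂ := min (E b T') (E a 0 + δ / 2)) hα.le
        hab hT' (lt_min hgt' (by linarith)) (by linarith)
        (fun x h₁ => hx x (ha.trans_le h₁)) (fun x h₁ => hy x (ha.trans_le h₁))
        (fun x h₁ y h₂ => (hp x (ha.trans_le h₁) y h₂).le)
        (fun x h₁ y h₂ => (hq x (ha.trans_le h₁) y h₂).le) ?_ ?_ ?_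
      · intro x h₁ y h₂ h₃ h₄
        have hx0 := ha.trans_le h₁
        have h₅ : d < g (E x y) := hball (by
          rw [Real.dist_eq, abs_lt]
          constructor <;> linarith [h₄.trans (min_le_right _ _)])
        have := hq x hx0 y h₂
        have : 0 < x + d := by positivity
        rw [hpq x hx0 y h₂]
        gcongr
      · intro y h₁
        exact (hanti a ha (mem_Ici.2 le_rfl) (mem_Ici.2 h₁.1.le) h₁.1).le
      · intro y h₁
        exact min_le_of_left_le
          ((hanti b hb).antitoneOn (mem_Ici.2 h₁.1.le) (mem_Ici.2 hT') h₁.2)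
    linarith

/-- A nowhere vanishing pair of partial derivatives of opposite signs has globally constant
signs on the quarter plane. -/
theorem partial_deriv_neg_or_pos {E Et ED : ℝ → ℝ → ℝ}
    (hEt : ∀ x > 0, ∀ y ≥ 0, HasDerivAt (fun y => E x y) (Et x y) y)
    (hED : ∀ x > 0, ∀ y ≥ 0, HasDerivAt (fun x => E x y) (ED x y) x)
    (hopp : ∀ x > 0, ∀ y ≥ 0, Et x y * ED x y < 0) :
    (∀ x > 0, ∀ y ≥ 0, Et x y < 0) ∨ ∀ x > 0, ∀ y ≥ 0, 0 < Et x y := by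
  have hcol : ∀ x > 0, (∀ y ∈ Ici (0 : ℝ), Et x y < 0) ∨ ∀ y ∈ Ici (0 : ℝ), 0 < Et x y :=
    fun x h₁ => hasDerivWithinAt_forall_lt_or_forall_gt_of_forall_ne (convex_Ici 0)
      (fun y h₂ => (hEt x h₁ y h₂).hasDerivWithinAt)
      fun y h₂ h => by simpa [h] using hopp x h₁ y h₂
  have hrow : (∀ x ∈ Ioi (0 : ℝ), ED x 0 < 0) ∨ ∀ x ∈ Ioi (0 : ℝ), 0 < ED x 0 :=
    hasDerivWithinAt_forall_lt_or_forall_gt_of_forall_ne (convex_Ioi 0)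
      (fun x h₁ => (hED x h₁ 0 le_rfl).hasDerivWithinAt)
      fun x h₁ h => by simpa [h] using hopp x h₁ 0 le_rfl
  rcases hrow with h | h
  · refine .inr fun x h₁ => (hcol x h₁).resolve_left fun h₂ => ?_
    nlinarith [hopp x h₁ 0 le_rfl, h x h₁, h₂ 0 self_mem_Ici]
  · refine .inl fun x h₁ => (hcol x h₁).resolve_right fun h₂ => ?_
    nlinarith [hopp x h₁ 0 le_rfl, h x h₁, h₂ 0 self_mem_Ici]


/-- The solution of the I-MMSE PDE is constant along characteristic curves
(core of Lemma A.3). `E Δ t` is the solution, `Et` and `ED` its partial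
derivatives in `t` and `Δ`. -/
theorem stmt_4 (α : ℝ) (E Et ED : ℝ → ℝ → ℝ) (Δ₀ : ℝ)
    (hα : 0 < α)
    (hpos : ∀ Δ t, 0 < Δ → 0 ≤ t → 0 < E Δ t)
    (hEt : ∀ Δ t, 0 < Δ → 0 ≤ t → HasDerivAt (fun s => E Δ s) (Et Δ t) t)
    (hED : ∀ Δ t, 0 < Δ → 0 ≤ t → HasDerivAt (fun d => E d t) (ED Δ t) Δ)
    (hPDE : ∀ Δ t, 0 < Δ → 0 ≤ t →
      α * Et Δ t / (Δ + E Δ t) ^ 2 = - ED Δ t)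
    (hEt_ne : ∀ Δ t, 0 < Δ → 0 ≤ t → Et Δ t ≠ 0)
    (hΔ₀ : 0 < Δ₀) :
    ∀ t : ℝ, 0 ≤ t →
      (∀ s ∈ Set.Icc 0 t,
        s < α / (Δ₀ + E Δ₀ 0) ∧
        0 < α / (α / (Δ₀ + E Δ₀ 0) - s) - E Δ₀ 0) →
      E (α / (α / (Δ₀ + E Δ₀ 0) - t) - E Δ₀ 0) t = E Δ₀ 0 := by
  intro t ht hs
  have hc := hpos Δ₀ 0 hΔ₀ le_rfl
  obtain ⟨htlt, hb⟩ := hs t ⟨ht, le_rfl⟩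
  set c := E Δ₀ 0
  set b := α / (α / (Δ₀ + c) - t) - c with hbdef
  have hbc : b + c = α / (α / (Δ₀ + c) - t) := by rw [hbdef]; ring
  have hsub : 0 < α / (Δ₀ + c) - t := sub_pos.2 htlt
  have hchar : α / (Δ₀ + c) - α / (b + c) = t := by
    rw [hbc, div_div_cancel₀ hα.ne']
    ring
  have hab : Δ₀ ≤ b := by
    have h₁ : α / (b + c) ≤ α / (Δ₀ + c) := by linarith
    have := (div_le_div_iff_of_pos_left hα (by positivity) (by positivity)).1 h₁
    linarith
  have hED_eq : ∀ x > 0, ∀ y ≥ 0, ED x y = -(α / (x + E x y) ^ 2 * Et x y) :=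
    fun x h₁ y h₂ => by
      rw [← neg_eq_iff_eq_neg, ← hPDE x y h₁ h₂]
      ring
  have hopp : ∀ x > 0, ∀ y ≥ 0, Et x y * ED x y < 0 := fun x h₁ y h₂ => by
    have := hpos x y h₁ h₂
    have : 0 < α / (x + E x y) ^ 2 := by positivity
    have := mul_pos this (sq_pos_of_ne_zero (hEt_ne x y h₁ h₂))
    rw [hED_eq x h₁ y h₂]
    linarith
  rcases partial_deriv_neg_or_pos (fun x h₁ y h₂ => hEt x y h₁ h₂)
    (fun x h₁ y h₂ => hED x y h₁ h₂) hopp with h | h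
  · refine eq_along_characteristic (q := fun x y => -Et x y) (g := id) hα continuous_id
      (fun x h₁ y h₂ => hpos x y h₁ h₂) (fun x h₁ y h₂ => hED x y h₁ h₂)
      (fun x h₁ y h₂ => (hEt x y h₁ h₂).congr_deriv (neg_neg _).symm)
      (fun x h₁ y h₂ => ?_) (fun x h₁ y h₂ => neg_pos.2 (h x h₁ y h₂)) hΔ₀ hab ht hchar
    rw [hED_eq x h₁ y h₂, id, mul_neg]
  · refine neg_injective (eq_along_characteristic (E := fun x y => -E x y)
      (p := fun x y => -ED x y) (q := Et) (g := fun e => -e) hα continuous_neg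
      (fun x h₁ y h₂ => ?_) (fun x h₁ y h₂ => (hED x y h₁ h₂).neg)
      (fun x h₁ y h₂ => (hEt x y h₁ h₂).neg) (fun x h₁ y h₂ => ?_) h hΔ₀ hab ht ?_)
    · simpa using hpos x y h₁ h₂
    · rw [hED_eq x h₁ y h₂, neg_neg, neg_neg]
    · simpa only [neg_neg] using hchar
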